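/- arXiv:2212.14163 — 8 statements merged into one kernel-verified Lean document; each statement's English description precedes it below -/
import Mathlib

section
/- Let l ≥ 1 and let Ā, B, V, Λ be real l×l matrices such that B is symmetric, Λ is a diagonal matrix with nonzero diagonal entries, Vᵀ B V = I (the identity matrix), and Ā V = B V Λ. Then V, B and Ā are invertible, and B Ā⁻¹ B = (V Λ Vᵀ)⁻¹. -/
open Matrix in
/-- If `B` is symmetric, `Λ = diagonal d` has nonzero diagonal entries,
`Vᵀ B V = I` and `Ā V = B V Λ`, then `V`, `B`, `Ā` are invertible and
`B Ā⁻¹ B = (V Λ Vᵀ)⁻¹`. -/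
theorem stmt1 (l : ℕ) (hl : 1 ≤ l)
    (A B V : Matrix (Fin l) (Fin l) ℝ) (d : Fin l → ℝ)
    (hB : B.IsSymm) (hd : ∀ i, d i ≠ 0)
    (hV : Vᵀ * B * V = 1)
    (hAV : A * V = B * V * Matrix.diagonal d) :
    IsUnit V ∧ IsUnit B ∧ IsUnit A ∧
      B * A⁻¹ * B = (V * Matrix.diagonal d * Vᵀ)⁻¹ := by
  have h1 : V * (Vᵀ * B) = 1 := mul_eq_one_comm.mp hV
  have uV : IsUnit V := IsUnit.of_mul_eq_one _ h1
  have h2 : B * (V * Vᵀ) = 1 := by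
    rw [mul_eq_one_comm, Matrix.mul_assoc]; exact h1
  have uB : IsUnit B := IsUnit.of_mul_eq_one _ h2
  have uVt : IsUnit Vᵀ := by
    refine IsUnit.of_mul_eq_one (B * V) ?_
    rw [← Matrix.mul_assoc]; exact hV
  have uD : IsUnit (Matrix.diagonal d) := by
    rw [Matrix.isUnit_diagonal, Pi.isUnit_iff]
    exact fun i => (hd i).isUnit
  have hA : A = B * (V * Matrix.diagonal d * Vᵀ) * B := by
    calc A = A * (V * (Vᵀ * B)) := by rw [h1, Matrix.mul_one]
      _ = (A * V) * (Vᵀ * B) := by simp only [Matrix.mul_assoc]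
      _ = _ := by rw [hAV]; simp only [Matrix.mul_assoc]
  have uM : IsUnit (V * Matrix.diagonal d * Vᵀ) := (uV.mul uD).mul uVt
  refine ⟨uV, uB, hA ▸ (uB.mul uM).mul uB, ?_⟩
  have dB : IsUnit B.det := (Matrix.isUnit_iff_isUnit_det B).mp uB
  rw [hA, Matrix.mul_inv_rev, Matrix.mul_inv_rev, Matrix.mul_nonsing_inv_cancel_left _ _ dB,
    Matrix.nonsing_inv_mul_cancel_right _ _ dB]
end

section
/- Let K ≥ 1, σ > 0, λ* > 0, let λ_0, …, λ_{K−1} > 0, and let (r_i)_{i∈ℕ} be a summable sequence of positive reals. If λ* > max_{0 ≤ i < K} λ_i / r_i, then Σ_{i<K} σ² λ_i / (λ_i² + σ² λ*) < Σ_{i<K} σ² / (λ_i + σ² / r_i) + Σ'_{i≥K} r_i. -/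
/-- Trace comparison (Theorem 4.4, first claim): if `λ* > max_{i<K} λ i / r i`, then the
trace of the data-adaptive posterior covariance is strictly smaller than that of the
fixed non-degenerate prior's posterior covariance. -/
theorem stmt5 (K : ℕ) (hK : 1 ≤ K) (σ lamStar : ℝ) (hσ : 0 < σ) (hlamStar : 0 < lamStar)
    (lam r : ℕ → ℝ) (hlampos : ∀ i < K, 0 < lam i)
    (hr : ∀ i, 0 < r i) (hrsum : Summable r)
    (hmax : ∀ i < K, lam i / r i < lamStar) :
    ∑ i ∈ Finset.range K, σ ^ 2 * lam i / (lam i ^ 2 + σ ^ 2 * lamStar)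
      < ∑ i ∈ Finset.range K, σ ^ 2 / (lam i + σ ^ 2 / r i) + ∑' i : ℕ, r (K + i) := by
  have htail : 0 ≤ ∑' i : ℕ, r (K + i) := tsum_nonneg fun i => (hr _).le
  have hsum : ∑ i ∈ Finset.range K, σ ^ 2 * lam i / (lam i ^ 2 + σ ^ 2 * lamStar)
      < ∑ i ∈ Finset.range K, σ ^ 2 / (lam i + σ ^ 2 / r i) := by
    apply Finset.sum_lt_sum_of_nonempty
    · exact Finset.nonempty_range_iff.mpr (by omega)
    · intro i hi
      have hiK := Finset.mem_range.mp hi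
      have h1 := hlampos i hiK
      have h2 := hr i
      have h3 := hmax i hiK
      have hs : 0 < σ ^ 2 := by positivity
      rw [div_lt_div_iff₀ (by positivity) (by positivity)]
      have h4 : σ ^ 2 * σ ^ 2 * (lam i / r i) < σ ^ 2 * σ ^ 2 * lamStar :=
        mul_lt_mul_of_pos_left h3 (by positivity)
      have h5 : σ ^ 2 * lam i * (lam i + σ ^ 2 / r i)
          = σ ^ 2 * lam i ^ 2 + σ ^ 2 * σ ^ 2 * (lam i / r i) := by ring
      rw [h5]
      linarith
  linarith
end

section
/- Let K ≥ 1, σ > 0, and let λ_0, …, λ_{K−1} > 0 and r_0, …, r_{K−1} > 0. If 0 < λ* < min_{0 ≤ i < K} λ_i / r_i, then Σ_{i<K} σ² λ_i / (λ_i² + σ² λ*) > Σ_{i<K} σ² / (λ_i + σ² / r_i). -/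
/-- Trace comparison (Theorem 4.4, second claim): if `0 < λ* < min_{i<K} λ i / r i`, then
the trace of the data-adaptive posterior covariance is strictly larger than that of the
degenerate prior's posterior covariance. -/
theorem stmt6 (K : ℕ) (hK : 1 ≤ K) (σ lamStar : ℝ) (hσ : 0 < σ)
    (lam r : ℕ → ℝ) (hlampos : ∀ i < K, 0 < lam i) (hr : ∀ i < K, 0 < r i)
    (hlamStar : 0 < lamStar) (hmin : ∀ i < K, lamStar < lam i / r i) :
    ∑ i ∈ Finset.range K, σ ^ 2 * lam i / (lam i ^ 2 + σ ^ 2 * lamStar)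
      > ∑ i ∈ Finset.range K, σ ^ 2 / (lam i + σ ^ 2 / r i) := by
  refine Finset.sum_lt_sum_of_nonempty (Finset.nonempty_range_iff.mpr (by omega)) ?_
  intro i hi
  have hi' := Finset.mem_range.mp hi
  have hl := hlampos i hi'
  have hri := hr i hi'
  have hm := hmin i hi'
  have hs : 0 < σ ^ 2 := by positivity
  rw [div_lt_div_iff₀ (by positivity) (by positivity)]
  have h1 : σ ^ 2 * σ ^ 2 * lamStar < σ ^ 2 * σ ^ 2 * (lam i / r i) :=
    mul_lt_mul_of_pos_left hm (by positivity)
  have h2 : σ ^ 2 * lam i * (lam i + σ ^ 2 / r i)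
      = σ ^ 2 * lam i ^ 2 + σ ^ 2 * σ ^ 2 * (lam i / r i) := by ring
  rw [h2]
  linarith
end

section
/- Let K ≥ 1, σ > 0, let λ_0, …, λ_{K−1} > 0, and let (r_i)_{i∈ℕ} and (ε_i)_{i∈ℕ} be real sequences with r_i > 0 for all i, (r_i) summable and (r_i² ε_i²) summable. If max_{0 ≤ i < K} λ_i / r_i ≤ λ* ≤ 1, then Σ_{i<K} (λ_i + σ² λ* / λ_i)⁻² [ σ² (λ_i + σ² λ*² / λ_i) + ε_i² ] < Σ_{i<K} (λ_i + σ² / r_i)⁻² [ σ² λ_i + σ⁴ / r_i + ε_i² ] + Σ'_{i≥K} ( r_i + σ⁻⁴ r_i² ε_i² ). -/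
/-- Expected MSE comparison (Theorem 4.3): if `max_{i<K} λ i / r i ≤ λ* ≤ 1`, the
expected mean-square error of the MAP estimator of the data-adaptive RKHS prior is
strictly smaller than that of the fixed non-degenerate prior. -/
theorem stmt7 (K : ℕ) (hK : 1 ≤ K) (σ lamStar : ℝ) (hσ : 0 < σ)
    (lam r ε : ℕ → ℝ) (hlampos : ∀ i < K, 0 < lam i)
    (hr : ∀ i, 0 < r i) (hrsum : Summable r)
    (hrεsum : Summable (fun i => r i ^ 2 * ε i ^ 2))
    (hmax : ∀ i < K, lam i / r i ≤ lamStar) (hlam1 : lamStar ≤ 1) :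
    ∑ i ∈ Finset.range K,
        (lam i + σ ^ 2 * lamStar / lam i)⁻¹ ^ 2
          * (σ ^ 2 * (lam i + σ ^ 2 * lamStar ^ 2 / lam i) + ε i ^ 2)
      < ∑ i ∈ Finset.range K,
          (lam i + σ ^ 2 / r i)⁻¹ ^ 2 * (σ ^ 2 * lam i + σ ^ 4 / r i + ε i ^ 2)
        + ∑' i : ℕ, (r (K + i) + σ⁻¹ ^ 4 * r (K + i) ^ 2 * ε (K + i) ^ 2) := by
  have htail : 0 < ∑' i : ℕ, (r (K + i) + σ⁻¹ ^ 4 * r (K + i) ^ 2 * ε (K + i) ^ 2) := by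
    have hinj : Function.Injective (fun i : ℕ => K + i) := fun a b h => by simpa using h
    have h1 : Summable (fun i : ℕ => r (K + i)) := hrsum.comp_injective hinj
    have h2 : Summable (fun i : ℕ => r (K + i) ^ 2 * ε (K + i) ^ 2) :=
      hrεsum.comp_injective hinj
    have h3 : Summable
        (fun i : ℕ => r (K + i) + σ⁻¹ ^ 4 * r (K + i) ^ 2 * ε (K + i) ^ 2) := by
      refine h1.add ((h2.mul_left (σ⁻¹ ^ 4)).congr fun i => ?_)
      ring
    have hpos : ∀ i : ℕ, 0 < r (K + i) + σ⁻¹ ^ 4 * r (K + i) ^ 2 * ε (K + i) ^ 2 := by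
      intro i
      have := hr (K + i)
      positivity
    exact h3.tsum_pos (fun i => (hpos i).le) 0 (hpos 0)
  refine lt_of_le_of_lt (Finset.sum_le_sum fun i hi => ?_) (lt_add_of_pos_right _ htail)
  have hi' := Finset.mem_range.mp hi
  have ha := hlampos i hi'
  have hri := hr i
  have hL := hmax i hi'
  have hLpos : 0 < lamStar := lt_of_lt_of_le (div_pos ha hri) hL
  have hq : σ ^ 2 / r i ≤ σ ^ 2 * lamStar / lam i := by
    rw [div_le_iff₀ hri] at hL
    rw [div_le_div_iff₀ hri ha]
    nlinarith [mul_le_mul_of_nonneg_left hL (sq_nonneg σ)]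
  have hB : 0 < lam i + σ ^ 2 / r i := by positivity
  have hAB : lam i + σ ^ 2 / r i ≤ lam i + σ ^ 2 * lamStar / lam i := by linarith
  have hA : 0 < lam i + σ ^ 2 * lamStar / lam i := lt_of_lt_of_le hB hAB
  have hinv : (lam i + σ ^ 2 * lamStar / lam i)⁻¹ ≤ (lam i + σ ^ 2 / r i)⁻¹ :=
    inv_anti₀ hB hAB
  have hsq : lam i + σ ^ 2 * lamStar ^ 2 / lam i ≤ lam i + σ ^ 2 * lamStar / lam i := by
    have : lamStar ^ 2 ≤ lamStar := by nlinarith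
    gcongr
  have hr4 : σ ^ 2 * lam i + σ ^ 4 / r i = σ ^ 2 * (lam i + σ ^ 2 / r i) := by ring
  rw [hr4]
  generalize lam i + σ ^ 2 * lamStar / lam i = A at *
  generalize lam i + σ ^ 2 / r i = B at *
  calc A⁻¹ ^ 2 * (σ ^ 2 * (lam i + σ ^ 2 * lamStar ^ 2 / lam i) + ε i ^ 2)
      ≤ A⁻¹ ^ 2 * (σ ^ 2 * A + ε i ^ 2) := by gcongr
    _ = σ ^ 2 * A⁻¹ + A⁻¹ ^ 2 * ε i ^ 2 := by field_simp
    _ ≤ σ ^ 2 * B⁻¹ + B⁻¹ ^ 2 * ε i ^ 2 := by gcongr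
    _ = B⁻¹ ^ 2 * (σ ^ 2 * B + ε i ^ 2) := by field_simp
end

section
/- Let H be a real Hilbert space, K ∈ ℕ, and let ψ_0, …, ψ_{K−1} ∈ H be orthonormal. Let λ_0, …, λ_{K−1} > 0, λ* > 0, and let a_i, e_i, ξ_i (for i < K) be real numbers. For σ > 0 define μ(σ) = Σ_{i<K} λ_i (λ_i² + σ² λ*)⁻¹ (λ_i a_i + σ λ_i^{1/2} e_i + ξ_i) • ψ_i ∈ H. Then as σ → 0⁺, μ(σ) converges in H to Σ_{i<K} (a_i + λ_i⁻¹ ξ_i) • ψ_i. In particular, if ξ_i = 0 for all i < K, the limit equals Σ_{i<K} a_i • ψ_i. -/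
/-- Small noise limit of the MAP estimator under the data-adaptive RKHS prior
(Theorem 4.2, spectral form): the posterior mean
`μ(σ) = ∑_{i<K} λ i (λ i ² + σ² λ*)⁻¹ (λ i • a i + σ √(λ i) e i + ξ i) • ψ i`
converges, as `σ → 0⁺`, to `∑_{i<K} (a i + λ i ⁻¹ ξ i) • ψ i`; in particular, if all
model-error coefficients `ξ i` vanish, the limit is `∑_{i<K} a i • ψ i`. -/
theorem stmt8 {H : Type*} [NormedAddCommGroup H] [InnerProductSpace ℝ H] [CompleteSpace H]
    (K : ℕ) (ψ : Fin K → H) (hψ : Orthonormal ℝ ψ)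
    (lam a e ξ : Fin K → ℝ) (hlam : ∀ i, 0 < lam i)
    (lamStar : ℝ) (hlamStar : 0 < lamStar)
    (μ : ℝ → H)
    (hμ : ∀ σ : ℝ, μ σ = ∑ i, (lam i * (lam i ^ 2 + σ ^ 2 * lamStar)⁻¹ *
        (lam i * a i + σ * Real.sqrt (lam i) * e i + ξ i)) • ψ i) :
    Filter.Tendsto μ (nhdsWithin 0 (Set.Ioi 0))
      (nhds (∑ i, (a i + (lam i)⁻¹ * ξ i) • ψ i)) ∧
    ((∀ i, ξ i = 0) →
      (∑ i, (a i + (lam i)⁻¹ * ξ i) • ψ i) = ∑ i, a i • ψ i) := by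
  refine ⟨?_, fun h => by simp [h]⟩
  have hc : Continuous μ := by
    rw [funext hμ]
    refine continuous_finset_sum _ fun i _ => Continuous.smul ?_ continuous_const
    have hne : ∀ σ : ℝ, lam i ^ 2 + σ ^ 2 * lamStar ≠ 0 := fun σ => by
      have := hlam i
      positivity
    have h1 : Continuous fun σ : ℝ => (lam i ^ 2 + σ ^ 2 * lamStar)⁻¹ :=
      Continuous.inv₀ (by fun_prop) hne
    fun_prop
  have h0 : μ 0 = ∑ i, (a i + (lam i)⁻¹ * ξ i) • ψ i := by
    rw [hμ]
    refine Finset.sum_congr rfl fun i _ => ?_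
    congr 1
    have := (hlam i).ne'
    simp only [zero_mul, ne_eq, OfNat.ofNat_ne_zero, not_false_eq_true, zero_pow, add_zero]
    field_simp
  rw [← h0]
  exact (hc.tendsto 0).mono_left nhdsWithin_le_nhds
end

section
/- Let K ∈ ℕ and let (λ_i), (r_i), (a_i), (e_i), (ξ_i) be real sequences indexed by ℕ with λ_i > 0 for i < K, λ_i = 0 for i ≥ K, r_i > 0 for all i, and (r_i² ξ_i²) summable. Suppose ξ_{i₀} ≠ 0 for some i₀ ≥ K. For σ > 0 define μ_i(σ) = (λ_i + σ² / r_i)⁻¹ (λ_i a_i + σ λ_i^{1/2} e_i + ξ_i). Then for each σ > 0 the family (μ_i(σ)²)_{i∈ℕ} is summable, and Σ'_{i} μ_i(σ)² → +∞ as σ → 0⁺. -/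
/-- Risk in a fixed non-degenerate prior (Proposition 3.2, spectral form): the squared
`L²_ρ`-norm of the posterior mean, `∑' i, μ_i(σ)²` with
`μ_i(σ) = (λ i + σ²/r i)⁻¹ (λ i a i + σ √(λ i) e i + ξ i)`, is finite for each `σ > 0`
but diverges to `+∞` as `σ → 0⁺` when some model-error coefficient outside the FSOI is
nonzero. -/
theorem stmt9 (K : ℕ) (lam r a e ξ : ℕ → ℝ)
    (hlampos : ∀ i < K, 0 < lam i) (hlamzero : ∀ i, K ≤ i → lam i = 0)
    (hr : ∀ i, 0 < r i) (hsum : Summable (fun i => r i ^ 2 * ξ i ^ 2))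
    (i₀ : ℕ) (hi₀ : K ≤ i₀) (hξ : ξ i₀ ≠ 0) :
    (∀ σ : ℝ, 0 < σ → Summable (fun i =>
        ((lam i + σ ^ 2 / r i)⁻¹ * (lam i * a i + σ * Real.sqrt (lam i) * e i + ξ i)) ^ 2)) ∧
    Filter.Tendsto (fun σ : ℝ => ∑' i : ℕ,
        ((lam i + σ ^ 2 / r i)⁻¹ * (lam i * a i + σ * Real.sqrt (lam i) * e i + ξ i)) ^ 2)
      (nhdsWithin 0 (Set.Ioi 0)) Filter.atTop := by
  have key : ∀ σ : ℝ, ∀ i, K ≤ i →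
      ((lam i + σ ^ 2 / r i)⁻¹ * (lam i * a i + σ * Real.sqrt (lam i) * e i + ξ i)) ^ 2
        = (σ⁻¹) ^ 4 * (r i ^ 2 * ξ i ^ 2) := by
    intro σ i hi
    rw [hlamzero i hi]
    simp only [Real.sqrt_zero, zero_mul, mul_zero, zero_add, inv_div]
    rw [div_eq_mul_inv, ← inv_pow]
    ring
  have hS : ∀ σ : ℝ, 0 < σ → Summable (fun i =>
        ((lam i + σ ^ 2 / r i)⁻¹ * (lam i * a i + σ * Real.sqrt (lam i) * e i + ξ i)) ^ 2) := by
    intro σ _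
    rw [← summable_nat_add_iff K]
    have h := (summable_nat_add_iff K).2 (hsum.mul_left ((σ⁻¹) ^ 4))
    refine h.congr ?_
    intro i
    first
      | exact key σ (i + K) (Nat.le_add_left K i)
      | exact (key σ (i + K) (Nat.le_add_left K i)).symm
  refine ⟨hS, ?_⟩
  have hc : 0 < r i₀ ^ 2 * ξ i₀ ^ 2 := by
    have := hr i₀
    positivity
  have ht : Filter.Tendsto (fun σ : ℝ => (σ⁻¹) ^ 4 * (r i₀ ^ 2 * ξ i₀ ^ 2))
      (nhdsWithin 0 (Set.Ioi 0)) Filter.atTop :=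
    ((Filter.tendsto_pow_atTop (by norm_num)).comp
      tendsto_inv_nhdsGT_zero).atTop_mul_const hc
  refine Filter.tendsto_atTop_mono' _ ?_ ht
  filter_upwards [self_mem_nhdsWithin] with σ hσ
  rw [← key σ i₀ hi₀]
  exact (hS σ hσ).le_tsum i₀ (fun j _ => sq_nonneg _)
end

section
/- Let K ∈ ℕ, C₀ > 0, 0 ≤ β < 1, and let (λ_i), (r_i), (a_i), (e_i), (ξ_i) be real sequences indexed by ℕ with λ_i > 0 for i < K, λ_i = 0 for i ≥ K, r_i > 0 for all i, and (r_i² ξ_i²) summable, and suppose ξ_{i₀} ≠ 0 for some i₀ ≥ K. For σ > 0 define μ_i(σ) = (λ_i + σ^{2−2β} C₀⁻¹ / r_i)⁻¹ (λ_i a_i + σ λ_i^{1/2} e_i + ξ_i); in particular μ_i(σ) = C₀ σ^{2β−2} r_i ξ_i for i ≥ K. Then for each σ > 0 the family (μ_i(σ)²) is summable, and Σ'_i μ_i(σ)² → +∞ as σ → 0⁺. -/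
/-- Risk in a noise-adaptive non-degenerate prior, case `β < 1` (Proposition 3.3): with
`μ_i(σ) = (λ i + σ^{2−2β} C₀⁻¹ / r i)⁻¹ (λ i a i + σ √(λ i) e i + ξ i)`, the squared
norm `∑' i, μ_i(σ)²` is finite for each `σ > 0` and diverges to `+∞` as `σ → 0⁺`. -/
theorem stmt10 (K : ℕ) (C₀ β : ℝ) (hC₀ : 0 < C₀) (hβ0 : 0 ≤ β) (hβ1 : β < 1)
    (lam r a e ξ : ℕ → ℝ)
    (hlampos : ∀ i < K, 0 < lam i) (hlamzero : ∀ i, K ≤ i → lam i = 0)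
    (hr : ∀ i, 0 < r i) (hsum : Summable (fun i => r i ^ 2 * ξ i ^ 2))
    (i₀ : ℕ) (hi₀ : K ≤ i₀) (hξ : ξ i₀ ≠ 0) :
    (∀ σ : ℝ, 0 < σ → Summable (fun i =>
        ((lam i + σ ^ (2 - 2 * β) * C₀⁻¹ / r i)⁻¹
          * (lam i * a i + σ * Real.sqrt (lam i) * e i + ξ i)) ^ 2)) ∧
    Filter.Tendsto (fun σ : ℝ => ∑' i : ℕ,
        ((lam i + σ ^ (2 - 2 * β) * C₀⁻¹ / r i)⁻¹
          * (lam i * a i + σ * Real.sqrt (lam i) * e i + ξ i)) ^ 2)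
      (nhdsWithin 0 (Set.Ioi 0)) Filter.atTop := by
  have key : ∀ σ : ℝ, 0 < σ → ∀ i, K ≤ i →
      ((lam i + σ ^ (2 - 2 * β) * C₀⁻¹ / r i)⁻¹
          * (lam i * a i + σ * Real.sqrt (lam i) * e i + ξ i)) ^ 2
        = (C₀ ^ 2 * (r i ^ 2 * ξ i ^ 2)) * ((σ ^ (2 - 2 * β))⁻¹) ^ 2 := by
    intro σ hσ i hi
    have hs : σ ^ (2 - 2 * β) ≠ 0 := (Real.rpow_pos_of_pos hσ _).ne'
    have hri := (hr i).ne'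
    have hc := hC₀.ne'
    rw [hlamzero i hi]
    simp only [Real.sqrt_zero, zero_mul, mul_zero, zero_add]
    generalize σ ^ (2 - 2 * β) = s at hs
    field_simp
  have hS : ∀ σ : ℝ, 0 < σ → Summable (fun i =>
        ((lam i + σ ^ (2 - 2 * β) * C₀⁻¹ / r i)⁻¹
          * (lam i * a i + σ * Real.sqrt (lam i) * e i + ξ i)) ^ 2) := by
    intro σ hσ
    rw [← summable_nat_add_iff K]
    have h := (((summable_nat_add_iff K).2 hsum).mul_left (C₀ ^ 2)).mul_right
      (((σ ^ (2 - 2 * β))⁻¹) ^ 2)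
    exact h.congr (fun i => by rw [key σ hσ (i + K) (Nat.le_add_left _ _)])
  refine ⟨hS, ?_⟩
  have hp : 0 < 2 - 2 * β := by linarith
  have h0 : Filter.Tendsto (fun σ : ℝ => σ ^ (2 - 2 * β)) (nhdsWithin 0 (Set.Ioi 0))
      (nhdsWithin 0 (Set.Ioi 0)) := by
    refine tendsto_nhdsWithin_iff.2 ⟨?_, ?_⟩
    · have h := (Real.continuousAt_rpow_const 0 (2 - 2 * β) (Or.inr hp.le)).tendsto
      rw [Real.zero_rpow hp.ne'] at h
      exact h.mono_left nhdsWithin_le_nhds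
    · filter_upwards [self_mem_nhdsWithin] with σ hσ
      exact Real.rpow_pos_of_pos hσ _
  have h1 := (Filter.tendsto_pow_atTop (α := ℝ) (two_ne_zero)).comp
    (tendsto_inv_nhdsGT_zero.comp h0)
  have hc : 0 < C₀ ^ 2 * (r i₀ ^ 2 * ξ i₀ ^ 2) := by
    have := hr i₀
    positivity
  refine Filter.tendsto_atTop_mono' _ ?_ (h1.const_mul_atTop hc)
  filter_upwards [self_mem_nhdsWithin] with σ hσ
  have h2 := (hS σ hσ).le_tsum i₀ (fun j _ => sq_nonneg _)
  rw [key σ hσ i₀ hi₀] at h2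
  exact h2
end

section
/- Let K ∈ ℕ, C₀ > 0, β > 1, and let (λ_i), (r_i), (a_i), (e_i), (ξ_i) be real sequences indexed by ℕ with λ_i > 0 for i < K, λ_i = 0 for i ≥ K, r_i > 0 for all i, and (r_i² ξ_i²) summable. For σ > 0 define μ_i(σ) = (λ_i + σ^{2−2β} C₀⁻¹ / r_i)⁻¹ (λ_i a_i + σ λ_i^{1/2} e_i + ξ_i); in particular μ_i(σ) = C₀ σ^{2β−2} r_i ξ_i for i ≥ K. Then for each σ > 0 the family (μ_i(σ)²) is summable, and Σ'_i μ_i(σ)² → 0 as σ → 0⁺; that is, the posterior mean converges to 0 in L²_ρ. -/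
/-- Risk in a noise-adaptive non-degenerate prior, case `β > 1` (Proposition 3.3): with
`μ_i(σ) = (λ i + σ^{2−2β} C₀⁻¹ / r i)⁻¹ (λ i a i + σ √(λ i) e i + ξ i)`, the squared
norm `∑' i, μ_i(σ)²` is finite for each `σ > 0` and tends to `0` as `σ → 0⁺`, i.e. the
posterior mean converges to `0` in `L²_ρ`. -/
theorem stmt12 (K : ℕ) (C₀ β : ℝ) (hC₀ : 0 < C₀) (hβ : 1 < β)
    (lam r a e ξ : ℕ → ℝ)
    (hlampos : ∀ i < K, 0 < lam i) (hlamzero : ∀ i, K ≤ i → lam i = 0)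
    (hr : ∀ i, 0 < r i) (hsum : Summable (fun i => r i ^ 2 * ξ i ^ 2)) :
    (∀ σ : ℝ, 0 < σ → Summable (fun i =>
        ((lam i + σ ^ (2 - 2 * β) * C₀⁻¹ / r i)⁻¹
          * (lam i * a i + σ * Real.sqrt (lam i) * e i + ξ i)) ^ 2)) ∧
    Filter.Tendsto (fun σ : ℝ => ∑' i : ℕ,
        ((lam i + σ ^ (2 - 2 * β) * C₀⁻¹ / r i)⁻¹
          * (lam i * a i + σ * Real.sqrt (lam i) * e i + ξ i)) ^ 2)
      (nhdsWithin 0 (Set.Ioi 0)) (nhds 0) := by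
  have htail : ∀ σ : ℝ, ∀ i : ℕ,
      ((lam (i + K) + σ ^ (2 - 2 * β) * C₀⁻¹ / r (i + K))⁻¹
          * (lam (i + K) * a (i + K) + σ * Real.sqrt (lam (i + K)) * e (i + K) + ξ (i + K))) ^ 2
        = ((σ ^ (2 - 2 * β))⁻¹ * C₀) ^ 2 * (r (i + K) ^ 2 * ξ (i + K) ^ 2) := by
    intro σ i
    rw [hlamzero (i + K) (Nat.le_add_left K i), Real.sqrt_zero]
    simp only [zero_add, zero_mul, mul_zero, inv_div, div_eq_mul_inv, mul_inv, inv_inv]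
    ring
  have hsumK : Summable (fun i => r (i + K) ^ 2 * ξ (i + K) ^ 2) :=
    (summable_nat_add_iff (f := fun i => r i ^ 2 * ξ i ^ 2) K).2 hsum
  have hS : ∀ σ : ℝ, Summable (fun i =>
        ((lam i + σ ^ (2 - 2 * β) * C₀⁻¹ / r i)⁻¹
          * (lam i * a i + σ * Real.sqrt (lam i) * e i + ξ i)) ^ 2) := by
    intro σ
    rw [← summable_nat_add_iff K]
    simp only [htail]
    exact hsumK.mul_left _
  refine ⟨fun σ _ => hS σ, ?_⟩
  have hpow : Filter.Tendsto (fun σ : ℝ => σ ^ (2 - 2 * β)) (nhdsWithin 0 (Set.Ioi 0))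
      Filter.atTop := tendsto_rpow_neg_nhdsGT_zero (by linarith)
  have hσ : Filter.Tendsto (fun σ : ℝ => σ) (nhdsWithin 0 (Set.Ioi 0)) (nhds 0) :=
    Filter.tendsto_id.mono_left nhdsWithin_le_nhds
  have hhead : ∀ i, Filter.Tendsto (fun σ : ℝ =>
        ((lam i + σ ^ (2 - 2 * β) * C₀⁻¹ / r i)⁻¹
          * (lam i * a i + σ * Real.sqrt (lam i) * e i + ξ i)) ^ 2)
      (nhdsWithin 0 (Set.Ioi 0)) (nhds 0) := by
    intro i
    have h1 := (Filter.tendsto_atTop_add_const_left _ (lam i)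
      ((hpow.atTop_mul_const (inv_pos.2 hC₀)).atTop_div_const (hr i))).inv_tendsto_atTop
    have h2 := (((hσ.mul_const (Real.sqrt (lam i))).mul_const (e i)).const_add
      (lam i * a i)).add_const (ξ i)
    simpa using (h1.mul h2).pow 2
  have hsplit : ∀ σ : ℝ, (∑' i : ℕ, ((lam i + σ ^ (2 - 2 * β) * C₀⁻¹ / r i)⁻¹
          * (lam i * a i + σ * Real.sqrt (lam i) * e i + ξ i)) ^ 2)
      = (∑ i ∈ Finset.range K, ((lam i + σ ^ (2 - 2 * β) * C₀⁻¹ / r i)⁻¹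
          * (lam i * a i + σ * Real.sqrt (lam i) * e i + ξ i)) ^ 2)
        + ((σ ^ (2 - 2 * β))⁻¹ * C₀) ^ 2 * ∑' i, (r (i + K) ^ 2 * ξ (i + K) ^ 2) := by
    intro σ
    rw [← (hS σ).sum_add_tsum_nat_add K]
    simp only [htail, tsum_mul_left]
  simp only [hsplit]
  have h3 := tendsto_finsetSum (Finset.range K) (fun i _ => hhead i)
  have h4 := ((hpow.inv_tendsto_atTop.mul_const C₀).pow 2).mul_const
    (∑' i, (r (i + K) ^ 2 * ξ (i + K) ^ 2))
  simpa using h3.add h4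
end
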